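/- Let h ∈ ℝ[x₁,…,x_m] be hyperbolic with respect to e ∈ Γ₊₊, let ξ₁,…,ξₙ be independent real random variables with finite supports, E[ξᵢ] = μᵢ and Var[ξᵢ] = τᵢ², and let v₁,…,vₙ ∈ Γ₊ satisfy Σ_{i=1}^n τᵢ² tr_h[vᵢ] vᵢ ⪯ e and rank_h(vᵢ) ≤ 1 for all i. Then the point (4, 0, …, 0) ∈ ℝ^{n+1} is above all roots of the (n+1)-variate polynomial ∏_{i=1}^n (1 − (1/2)∂²/∂zᵢ²) [ h(xe + Σ_{i=1}^n zᵢτᵢvᵢ) ]² ∈ ℝ[x, z₁,…,zₙ]. -/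

import Mathlib

open MvPolynomial Finset
open scoped Classical

noncomputable section

/-- `h` is homogeneous of degree `d`, positive at `e`, and for every `x` the univariate
polynomial `t ↦ h (t • e - x)` factors with real roots `lam x 1 ≥ … ≥ lam x d`
(the hyperbolic eigenvalues of `x`). -/
def IsHyperbolic {m d : ℕ} (h : MvPolynomial (Fin m) ℝ) (e : Fin m → ℝ)
    (lam : (Fin m → ℝ) → Fin d → ℝ) : Prop :=
  h.IsHomogeneous d ∧ 0 < eval e h ∧ (∀ x, Antitone (lam x)) ∧
    ∀ x : Fin m → ℝ, ∀ t : ℝ,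
      eval (t • e - x) h = eval e h * ∏ i, (t - lam x i)

/-- hyperbolic trace: the sum of the hyperbolic eigenvalues. -/
def htrace {m d : ℕ} (lam : (Fin m → ℝ) → Fin d → ℝ) (x : Fin m → ℝ) : ℝ :=
  ∑ i, lam x i

/-- hyperbolic rank: the number of nonzero hyperbolic eigenvalues. -/
def hrank {m d : ℕ} (lam : (Fin m → ℝ) → Fin d → ℝ) (x : Fin m → ℝ) : ℕ :=
  Nat.card {i : Fin d // lam x i ≠ 0}

/-- hyperbolic norm: the largest absolute value of a hyperbolic eigenvalue. -/
def hnorm {m d : ℕ} (lam : (Fin m → ℝ) → Fin d → ℝ) (x : Fin m → ℝ) : ℝ :=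
  ⨆ i, |lam x i|

/-- closed hyperbolicity cone: all hyperbolic eigenvalues nonnegative. -/
def InCone {m d : ℕ} (lam : (Fin m → ℝ) → Fin d → ℝ) (x : Fin m → ℝ) : Prop :=
  ∀ i, 0 ≤ lam x i

/-- open hyperbolicity cone: all hyperbolic eigenvalues positive. -/
def InOpenCone {m d : ℕ} (lam : (Fin m → ℝ) → Fin d → ℝ) (x : Fin m → ℝ) : Prop :=
  ∀ i, 0 < lam x i

/-- the `(n+1)`-variate polynomial `h (x • e + ∑ i, z i • w i)` in variables
`x = X 0` and `z i = X i.succ`. -/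
def hPoly {m n : ℕ} (h : MvPolynomial (Fin m) ℝ) (e : Fin m → ℝ)
    (w : Fin n → Fin m → ℝ) : MvPolynomial (Fin (n + 1)) ℝ :=
  aeval (fun j : Fin m =>
    X (0 : Fin (n + 1)) * C (e j) + ∑ i : Fin n, X i.succ * C (w i j)) h

/-- apply the operator `∏ i (1 - (1/2) ∂²_{z i})` to a polynomial in variables
`x = X 0, z 1 = X 1, …, z n = X n`. -/
def opAll {n : ℕ} (P : MvPolynomial (Fin (n + 1)) ℝ) : MvPolynomial (Fin (n + 1)) ℝ :=
  (List.finRange n).foldl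
    (fun Q i => Q - C (1 / 2 : ℝ) * pderiv i.succ (pderiv i.succ Q)) P

/-- `y` is above all roots of `P`: `P` is positive on `y` plus the nonnegative orthant. -/
def AboveRoots {k : ℕ} (P : MvPolynomial (Fin k) ℝ) (y : Fin k → ℝ) : Prop :=
  ∀ t : Fin k → ℝ, (∀ i, 0 ≤ t i) → 0 < eval (y + t) P

/-! ### Univariate polynomials -/

lemma Polynomial.norm_eval_le_of_roots (p : Polynomial ℂ) {z w : ℂ} {K : ℝ}
    (hK : ∀ ρ, p.eval ρ = 0 → ‖w - ρ‖ ≤ K * ‖z - ρ‖) (hK1 : 1 ≤ K) {d : ℕ}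
    (hd : p.natDegree ≤ d) : ‖p.eval w‖ ≤ K ^ d * ‖p.eval z‖ := by
  by_cases hp : p = 0
  · simp [hp]
  have hs := IsAlgClosed.splits p
  have key : ∀ s : Multiset ℂ, (∀ ρ ∈ s, ‖w - ρ‖ ≤ K * ‖z - ρ‖) →
      ‖(s.map fun a => w - a).prod‖ ≤ K ^ (Multiset.card s) * ‖(s.map fun a => z - a).prod‖ := by
    intro s
    induction s using Multiset.induction with
    | empty => simp
    | cons a s ih =>
      intro hall
      have h1 := ih fun ρ hρ => hall ρ (Multiset.mem_cons_of_mem hρ)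
      have h2 := hall a (Multiset.mem_cons_self a s)
      simp only [Multiset.map_cons, Multiset.prod_cons, norm_mul, Multiset.card_cons]
      calc _ ≤ (K * ‖z - a‖) * (K ^ (Multiset.card s) * ‖(s.map fun a => z - a).prod‖) := by
            gcongr
        _ = _ := by ring
  have h1 := key p.roots fun ρ hρ => hK ρ (Polynomial.isRoot_of_mem_roots hρ)
  rw [hs.eval_eq_prod_roots, hs.eval_eq_prod_roots, norm_mul, norm_mul]
  have h2 : K ^ (Multiset.card p.roots) ≤ K ^ d :=
    pow_le_pow_right₀ hK1 ((Polynomial.card_roots' p).trans hd)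
  calc _ ≤ ‖p.leadingCoeff‖ * (K ^ (Multiset.card p.roots) *
        ‖(p.roots.map fun a => z - a).prod‖) := by gcongr
    _ ≤ ‖p.leadingCoeff‖ * (K ^ d * ‖(p.roots.map fun a => z - a).prod‖) := by gcongr
    _ = _ := by ring

/-- A polynomial without zeros in the closed upper half plane has logarithmic derivative of
nonpositive imaginary part at the origin. -/
lemma Polynomial.im_derivative_mul_conj_nonpos (p : Polynomial ℂ)
    (hp : ∀ z : ℂ, 0 ≤ z.im → p.eval z ≠ 0) :
    (p.derivative.eval 0 * (starRingEnd ℂ) (p.eval 0)).im ≤ 0 := by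
  have h0 : p.eval 0 ≠ 0 := hp 0 (by simp)
  have hs := (IsAlgClosed.splits p).eval_derivative_div_eval_of_ne_zero h0
  have key : ∀ s : Multiset ℂ, (∀ ρ ∈ s, ρ.im < 0) →
      ((s.map fun a => 1 / (0 - a)).sum).im ≤ 0 := by
    intro s
    induction s using Multiset.induction with
    | empty => simp
    | cons a s ih =>
      intro hall
      have h1 := ih fun ρ hρ => hall ρ (Multiset.mem_cons_of_mem hρ)
      have h2 := hall a (Multiset.mem_cons_self a s)
      simp only [Multiset.map_cons, Multiset.sum_cons, Complex.add_im]
      have : (1 / (0 - a)).im ≤ 0 := by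
        simp only [zero_sub, one_div, Complex.inv_im, Complex.neg_im, neg_neg]
        exact div_nonpos_of_nonpos_of_nonneg h2.le (Complex.normSq_nonneg _)
      linarith
  have h1 := key p.roots fun ρ hρ => by
    by_contra hc
    exact hp ρ (not_lt.1 hc) (Polynomial.isRoot_of_mem_roots hρ)
  rw [← hs] at h1
  have h2 : p.derivative.eval 0 * (starRingEnd ℂ) (p.eval 0) =
      (p.derivative.eval 0 / p.eval 0) * (Complex.normSq (p.eval 0) : ℂ) := by
    rw [← Complex.mul_conj]; field_simp
  rw [h2, Complex.im_mul_ofReal]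
  exact mul_nonpos_of_nonpos_of_nonneg h1 (Complex.normSq_nonneg _)

/-! ### Restriction of a multivariate polynomial to a line -/

section Line

variable {σ K : Type*} [Field K] [Algebra ℝ K]

/-- The univariate polynomial `t ↦ Q (V + t • W)`. -/
def linePoly (Q : MvPolynomial σ ℝ) (V W : σ → K) : Polynomial K :=
  aeval (fun j => Polynomial.C (V j) + Polynomial.C (W j) * Polynomial.X) Q

lemma eval_linePoly (Q : MvPolynomial σ ℝ) (V W : σ → K) (z : K) :
    (linePoly Q V W).eval z = aeval (V + z • W) Q := by
  have h1 : ∀ p : Polynomial K, p.eval z = ((Polynomial.aeval z).restrictScalars ℝ) p := by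
    intro p; rw [AlgHom.restrictScalars_apply, Polynomial.coe_aeval_eq_eval]
  rw [h1, linePoly, ← AlgHom.comp_apply, MvPolynomial.comp_aeval]
  congr 2
  ext j
  change (Polynomial.aeval z) (Polynomial.C (V j) + Polynomial.C (W j) * Polynomial.X) =
    V j + z * W j
  rw [Polynomial.coe_aeval_eq_eval]
  simp only [Polynomial.eval_add, Polynomial.eval_mul, Polynomial.eval_C, Polynomial.eval_X]
  ring

lemma natDegree_linePoly_le {d : ℕ} (Q : MvPolynomial σ ℝ) (hQ : Q.totalDegree ≤ d)
    (V W : σ → K) : (linePoly Q V W).natDegree ≤ d := by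
  rw [linePoly, MvPolynomial.aeval_def, MvPolynomial.eval₂_eq]
  refine Polynomial.natDegree_sum_le_of_forall_le _ _ fun s hs => ?_
  refine (Polynomial.natDegree_mul_le).trans ?_
  have h1 : ((algebraMap ℝ (Polynomial K)) (coeff s Q)).natDegree = 0 := by
    rw [Polynomial.algebraMap_apply]; simp
  rw [h1, zero_add]
  refine (Polynomial.natDegree_prod_le _ _).trans ?_
  refine le_trans ?_ ((MvPolynomial.le_totalDegree hs).trans hQ)
  rw [Finsupp.sum]
  refine Finset.sum_le_sum fun i _ => ?_
  refine (Polynomial.natDegree_pow_le).trans ?_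
  have : (Polynomial.C (V i) + Polynomial.C (W i) * Polynomial.X).natDegree ≤ 1 := by
    compute_degree
  exact (Nat.mul_le_mul_left (s i) this).trans (mul_one _).le

lemma derivative_linePoly_single [DecidableEq σ] (Q : MvPolynomial σ ℝ) (V : σ → K) (i : σ) :
    Polynomial.derivative (linePoly Q V (Pi.single i 1)) =
      linePoly (pderiv i Q) V (Pi.single i 1) := by
  simp only [linePoly]
  induction Q using MvPolynomial.induction_on with
  | C a => simp [Polynomial.algebraMap_apply]
  | add p q hp hq => simp [hp, hq]
  | mul_X p j hp =>
    simp only [map_mul, Polynomial.derivative_mul, hp, pderiv_mul, map_add, aeval_X]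
    congr 1
    by_cases hij : j = i
    · subst hij; simp
    · simp [pderiv_X_of_ne hij, Pi.single_eq_of_ne hij]

end Line

lemma MvPolynomial.pderiv_pderiv_comm {σ : Type*} (i j : σ) (Q : MvPolynomial σ ℝ) :
    pderiv i (pderiv j Q) = pderiv j (pderiv i Q) := by
  have : ⁅pderiv (R := ℝ) i, pderiv (R := ℝ) j⁆ = 0 := by
    refine MvPolynomial.derivation_ext fun k => ?_
    rw [Derivation.commutator_apply]
    classical
    simp only [pderiv_X]
    by_cases h1 : k = i <;> by_cases h2 : k = j <;> simp [Pi.single_apply, h1, h2] <;>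
      split_ifs <;> simp
  have h := congrArg (fun D => D Q) this
  simpa [Derivation.commutator_apply, sub_eq_zero] using h

lemma Polynomial.eval_of_derivative_three {K : Type*} [Field K] [CharZero K] (p : Polynomial K)
    (hp : p.derivative.derivative.derivative = 0) (z : K) :
    p.eval z = p.eval 0 + z * p.derivative.eval 0 +
      z ^ 2 * (1 / 2 * p.derivative.derivative.eval 0) := by
  have h1 : p.natDegree ≤ 2 := by
    rw [Polynomial.natDegree_le_iff_coeff_eq_zero]
    intro N hN
    obtain ⟨k, rfl⟩ : ∃ k, N = k + 3 := ⟨N - 3, by omega⟩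
    have h2 := congrArg (fun q => Polynomial.coeff q k) hp
    simp only [Polynomial.coeff_derivative, Polynomial.coeff_zero, mul_eq_zero] at h2
    have h3 : ∀ j : ℕ, (j : K) + 1 ≠ 0 := fun j => by exact_mod_cast Nat.succ_ne_zero j
    rcases h2 with (h2 | h2) | h2
    · rcases h2 with h2 | h2
      · exact h2
      · exact absurd h2 (h3 _)
    · exact absurd h2 (h3 _)
    · exact absurd h2 (h3 _)
  have h2 := p.as_sum_range_C_mul_X_pow' (n := 3) (by omega)
  have e0 : p.eval 0 = p.coeff 0 := (Polynomial.coeff_zero_eq_eval_zero p).symm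
  have e1 : p.derivative.eval 0 = p.coeff 1 := by
    rw [← Polynomial.coeff_zero_eq_eval_zero, Polynomial.coeff_derivative]; simp
  have e2 : p.derivative.derivative.eval 0 = p.coeff 2 * 2 := by
    rw [← Polynomial.coeff_zero_eq_eval_zero, Polynomial.coeff_derivative,
      Polynomial.coeff_derivative]; norm_num
  rw [e0, e1, e2]
  conv_lhs => rw [h2]
  simp [Finset.sum_range_succ, Polynomial.eval_add]
  ring

lemma aeval_add_single_of_cubic {σ K : Type*} [DecidableEq σ] [Field K] [Algebra ℝ K] [CharZero K]
    (Q : MvPolynomial σ ℝ) (i : σ) (hQ : pderiv i (pderiv i (pderiv i Q)) = 0)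
    (V : σ → K) (z : K) :
    aeval (V + z • Pi.single i 1) Q = aeval V Q + z * aeval V (pderiv i Q) +
      z ^ 2 * (1 / 2 * aeval V (pderiv i (pderiv i Q))) := by
  have h := Polynomial.eval_of_derivative_three (linePoly Q V (Pi.single i 1))
    (by simp only [derivative_linePoly_single, hQ]; simp [linePoly]) z
  simpa only [derivative_linePoly_single, eval_linePoly, zero_smul, add_zero] using h
/-! ### Hyperbolicity cones -/

section Cone

variable {m d : ℕ} {h : MvPolynomial (Fin m) ℝ} {e : Fin m → ℝ} {lam : (Fin m → ℝ) → Fin d → ℝ}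

/-- A real vector seen as a complex vector. -/
def complexify {k : ℕ} (y : Fin k → ℝ) : Fin k → ℂ := fun j => (y j : ℂ)

lemma aeval_complexify {k : ℕ} (Q : MvPolynomial (Fin k) ℝ) (y : Fin k → ℝ) :
    aeval (complexify y) Q = ((eval y Q : ℝ) : ℂ) := by
  have := MvPolynomial.aeval_algebraMap_apply (A := ℝ) ℂ y Q
  rw [MvPolynomial.aeval_eq_eval] at this
  exact this

lemma continuous_aeval_complex {k : ℕ} (Q : MvPolynomial (Fin k) ℝ) :
    Continuous fun V : Fin k → ℂ => aeval V Q := by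
  have : (fun V : Fin k → ℂ => aeval V Q) = fun V => eval V (map (algebraMap ℝ ℂ) Q) := by
    ext V; rw [MvPolynomial.eval_map, MvPolynomial.aeval_def]
  rw [this]
  exact MvPolynomial.continuous_eval _

lemma MvPolynomial.IsHomogeneous.aeval_smul {K : Type*} [Field K] [Algebra ℝ K]
    (hh : h.IsHomogeneous d) (c : K) (V : Fin m → K) :
    MvPolynomial.aeval (c • V) h = c ^ d * MvPolynomial.aeval V h := by
  rw [MvPolynomial.aeval_def, MvPolynomial.aeval_def, MvPolynomial.eval₂_eq,
    MvPolynomial.eval₂_eq, Finset.mul_sum]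
  refine Finset.sum_congr rfl fun s hs => ?_
  have hd : ∑ i ∈ s.support, s i = d := by
    have := hh (MvPolynomial.mem_support_iff.1 hs)
    rwa [Finsupp.weight_apply, Finsupp.sum, Finset.sum_congr rfl (g := fun i => s i)] at this
    intro i _; simp
  simp only [Pi.smul_apply, smul_eq_mul, mul_pow, Finset.prod_mul_distrib, Finset.prod_pow_eq_pow_sum,
    hd]
  ring

lemma IsHyperbolic.aeval_smul_sub (hh : IsHyperbolic h e lam) (y : Fin m → ℝ) (x : ℂ) :
    aeval (x • complexify e - complexify y) h =
      (eval e h : ℂ) * ∏ i, (x - (lam y i : ℂ)) := by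
  have key : linePoly h (-complexify y) (complexify e) =
      Polynomial.C (eval e h : ℂ) * ∏ i, (Polynomial.X - Polynomial.C (lam y i : ℂ)) := by
    refine Polynomial.eq_of_infinite_eval_eq _ _ ?_
    refine (Set.infinite_range_of_injective Complex.ofReal_injective).mono ?_
    rintro _ ⟨t, rfl⟩
    have h1 := hh.2.2.2 y t
    have h2 : -complexify y + (t : ℂ) • complexify e = complexify (t • e - y) := by
      ext j; simp [complexify]; ring
    simp only [Set.mem_ofPred_eq, eval_linePoly, h2, aeval_complexify, h1]
    simp [Polynomial.eval_prod]
  have h3 := congrArg (Polynomial.eval x) key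
  rw [eval_linePoly] at h3
  rw [sub_eq_neg_add, h3]
  simp [Polynomial.eval_prod]

/-- Nonvanishing form of membership in the closed hyperbolicity cone. -/
def MemCone (h : MvPolynomial (Fin m) ℝ) (e c : Fin m → ℝ) : Prop :=
  ∀ t : ℝ, 0 < t → eval (t • e + c) h ≠ 0

lemma IsHyperbolic.eval_smul_add (hh : IsHyperbolic h e lam) (c : Fin m → ℝ) (t : ℝ) :
    eval (t • e + c) h = eval e h * ∏ i, (t - lam (-c) i) := by
  rw [← hh.2.2.2 (-c) t, sub_neg_eq_add]

lemma IsHyperbolic.lam_neg_nonpos (hh : IsHyperbolic h e lam) {c : Fin m → ℝ}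
    (hc : MemCone h e c) (j : Fin d) : lam (-c) j ≤ 0 := by
  by_contra hj
  refine hc _ (not_le.1 hj) ?_
  rw [hh.eval_smul_add, Finset.prod_eq_zero (Finset.mem_univ j) (sub_self _), mul_zero]

lemma IsHyperbolic.eval_pos_of_memCone (hh : IsHyperbolic h e lam) {c : Fin m → ℝ}
    (hc : MemCone h e c) {t : ℝ} (ht : 0 < t) : 0 < eval (t • e + c) h := by
  rw [hh.eval_smul_add]
  refine mul_pos hh.2.1 (Finset.prod_pos fun j _ => ?_)
  have := hh.lam_neg_nonpos hc j
  linarith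

lemma eval_smul_of_isHomogeneous (hh : h.IsHomogeneous d) (c : ℝ) (y : Fin m → ℝ) :
    eval (c • y) h = c ^ d * eval y h := by
  have := hh.aeval_smul c y
  simpa only [MvPolynomial.aeval_eq_eval] using this

/-- Evaluation of `h` at a real combination of `e` and `y`. -/
lemma IsHyperbolic.eval_smul_sub_smul (hh : IsHyperbolic h e lam) (y : Fin m → ℝ) {z : ℝ}
    (hz : z ≠ 0) (x : ℝ) :
    eval (x • e - z • y) h = eval e h * ∏ i, (x - z * lam y i) := by
  have h1 : x • e - z • y = z • ((x / z) • e - y) := by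
    rw [smul_sub, smul_smul, mul_div_cancel₀ _ hz]
  rw [h1, eval_smul_of_isHomogeneous hh.1, hh.2.2.2]
  have h2 : ∏ i, (x - z * lam y i) = z ^ d * ∏ i, (x / z - lam y i) := by
    have : z ^ d = ∏ _i : Fin d, z := by simp
    rw [this, ← Finset.prod_mul_distrib]
    refine Finset.prod_congr rfl fun i _ => ?_
    field_simp
  rw [h2]; ring

lemma IsHyperbolic.memCone_smul_sub_smul (hh : IsHyperbolic h e lam) {y : Fin m → ℝ} {x z : ℝ}
    (hz : z ≠ 0) (hy : ∀ j, z * lam y j ≤ x) : MemCone h e (x • e - z • y) := by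
  intro t ht
  have h1 : t • e + (x • e - z • y) = (t + x) • e - z • y := by rw [add_smul]; abel
  rw [h1, hh.eval_smul_sub_smul y hz]
  refine mul_ne_zero hh.2.1.ne' (Finset.prod_ne_zero_iff.2 fun j _ => ?_)
  have := hy j
  linarith

lemma IsHyperbolic.memCone_of_inCone (hh : IsHyperbolic h e lam) {y : Fin m → ℝ}
    (hy : InCone lam y) : MemCone h e y := by
  have := hh.memCone_smul_sub_smul (y := y) (x := 0) (z := -1) (by norm_num)
    (fun j => by have := hy j; linarith)
  simpa using this

lemma MemCone.smul (hh : h.IsHomogeneous d) {c : Fin m → ℝ} (hc : MemCone h e c) {s : ℝ}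
    (hs : 0 < s) : MemCone h e (s • c) := by
  intro t ht
  have h1 : t • e + s • c = s • ((t / s) • e + c) := by
    rw [smul_add, smul_smul, mul_div_cancel₀ _ hs.ne']
  rw [h1, eval_smul_of_isHomogeneous hh]
  exact mul_ne_zero (pow_ne_zero _ hs.ne') (hc _ (div_pos ht hs))

lemma IsHyperbolic.memCone_zero (hh : IsHyperbolic h e lam) : MemCone h e 0 := by
  intro t ht
  rw [add_zero, eval_smul_of_isHomogeneous hh.1]
  exact mul_ne_zero (pow_ne_zero _ ht.ne') hh.2.1.ne'

lemma IsHyperbolic.exists_memCone_smul_add (hh : IsHyperbolic h e lam) (u : Fin m → ℝ) :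
    ∃ X : ℝ, ∀ x, X ≤ x → MemCone h e (x • e + u) := by
  refine ⟨∑ j, |lam (-u) j|, fun x hx t ht => ?_⟩
  rw [← add_assoc, ← add_smul, hh.eval_smul_add]
  refine mul_ne_zero hh.2.1.ne' (Finset.prod_ne_zero_iff.2 fun j _ => ?_)
  have h1 := Finset.single_le_sum (f := fun j => |lam (-u) j|) (fun i _ => abs_nonneg _)
    (Finset.mem_univ j)
  have h2 := le_abs_self (lam (-u) j)
  have h3 : |lam (-u) j| ≤ ∑ j, |lam (-u) j| := h1
  intro h4
  linarith

lemma IsHyperbolic.aeval_real_add_ne_zero (hh : IsHyperbolic h e lam) (u : Fin m → ℝ) {x : ℂ}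
    (hx : 0 < x.im) : aeval (complexify u + x • complexify e) h ≠ 0 := by
  have h1 : complexify u + x • complexify e = x • complexify e - complexify (-u) := by
    ext j; simp [complexify]; ring
  rw [h1, hh.aeval_smul_sub]
  refine mul_ne_zero (by exact_mod_cast hh.2.1.ne') (Finset.prod_ne_zero_iff.2 fun j _ hj => ?_)
  have := congrArg Complex.im hj
  simp at this
  linarith

lemma IsHyperbolic.aeval_smul_add_smul_ne_zero (hh : IsHyperbolic h e lam) {c : Fin m → ℝ}
    (hc : MemCone h e c) {ε : ℝ} (hε : 0 ≤ ε) {x z : ℂ} (hx : 0 < x.im) (hz : 0 ≤ z.im) :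
    aeval (x • complexify e + z • complexify (c + ε • e)) h ≠ 0 := by
  by_cases hz0 : z = 0
  · have := hh.aeval_real_add_ne_zero 0 hx
    have h1 : complexify (0 : Fin m → ℝ) = 0 := by ext j; simp [complexify]
    simpa [hz0, h1] using this
  have h1 : x • complexify e + z • complexify (c + ε • e) =
      z • ((x / z + ε) • complexify e - complexify (-c)) := by
    ext j; simp [complexify]; field_simp; ring
  rw [h1, hh.1.aeval_smul, hh.aeval_smul_sub]
  refine mul_ne_zero (pow_ne_zero _ hz0) (mul_ne_zero (by exact_mod_cast hh.2.1.ne')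
    (Finset.prod_ne_zero_iff.2 fun j _ hj => ?_))
  have h2 := hh.lam_neg_nonpos hc j
  have h3 : x = z * ((lam (-c) j - ε : ℝ) : ℂ) := by
    have : x / z = ((lam (-c) j - ε : ℝ) : ℂ) := by push_cast; linear_combination hj
    rw [← this]; field_simp
  have h4 := congrArg Complex.im h3
  rw [Complex.im_mul_ofReal] at h4
  have : z.im * (lam (-c) j - ε) ≤ 0 := mul_nonpos_of_nonneg_of_nonpos hz (by linarith)
  linarith

/-- Continuation argument: absence of zeros in the upper half plane persists along a homotopy
without real zeros. -/
lemma aeval_ne_zero_of_homotopy (hh : h.IsHomogeneous d) (V U c : Fin m → ℂ)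
    (hc : aeval c h ≠ 0)
    (hreal : ∀ θ : ℝ, 0 ≤ θ → θ ≤ 1 → ∀ t : ℝ, aeval (V + (θ : ℂ) • U + (t : ℂ) • c) h ≠ 0)
    (hstart : ∀ z : ℂ, 0 ≤ z.im → aeval (V + z • c) h ≠ 0) (z : ℂ) (hz : 0 ≤ z.im) :
    aeval (V + U + z • c) h ≠ 0 := by
  intro hzero
  set F : ℝ → ℂ → ℂ := fun θ z => aeval (V + (θ : ℂ) • U + z • c) h with hF
  have hFc : Continuous fun q : ℝ × ℂ => F q.1 q.2 := by
    refine (continuous_aeval_complex h).comp ?_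
    fun_prop
  obtain ⟨R, hR⟩ : ∃ R : ℝ, ∀ θ : ℝ, 0 ≤ θ → θ ≤ 1 → ∀ z : ℂ, F θ z = 0 → ‖z‖ ≤ R := by
    obtain ⟨δ, hδ, hball⟩ := Metric.eventually_nhds_iff.1
      ((continuous_aeval_complex h).continuousAt.eventually_ne hc)
    refine ⟨(‖V‖ + ‖U‖) / δ, fun θ h0 h1 z hFz => ?_⟩
    by_contra hlt
    rw [not_le, div_lt_iff₀ hδ] at hlt
    have hz0 : z ≠ 0 := by
      rintro rfl
      rw [norm_zero, zero_mul] at hlt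
      have := norm_nonneg V
      have := norm_nonneg U
      linarith
    have hzn : 0 < ‖z‖ := norm_pos_iff.2 hz0
    have h2 : V + (θ : ℂ) • U + z • c = z • (c + z⁻¹ • (V + (θ : ℂ) • U)) := by
      rw [smul_add, smul_smul, mul_inv_cancel₀ hz0, one_smul]; abel
    have h3 : F θ z = z ^ d * aeval (c + z⁻¹ • (V + (θ : ℂ) • U)) h := by
      rw [hF]; simp only [h2]; rw [hh.aeval_smul]
    rw [h3] at hFz
    refine mul_ne_zero (pow_ne_zero _ hz0) (hball (y := c + z⁻¹ • (V + (θ : ℂ) • U)) ?_) hFz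
    rw [dist_eq_norm, add_sub_cancel_left, norm_smul, norm_inv, inv_mul_lt_iff₀ hzn]
    calc ‖V + (θ : ℂ) • U‖ ≤ ‖V‖ + ‖(θ : ℂ) • U‖ := norm_add_le _ _
      _ ≤ ‖V‖ + ‖U‖ := by
        rw [norm_smul, Complex.norm_real, Real.norm_of_nonneg h0]
        have := mul_le_of_le_one_left (norm_nonneg U) h1
        linarith
      _ < ‖z‖ * δ := hlt
  set S : Set (ℝ × ℂ) := {q | 0 ≤ q.1 ∧ q.1 ≤ 1 ∧ 0 ≤ q.2.im ∧ F q.1 q.2 = 0} with hS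
  have hScomp : IsCompact S := by
    refine (isCompact_Icc.prod (isCompact_closedBall (0 : ℂ) R)).of_isClosed_subset ?_ ?_
      (s := Set.Icc (0 : ℝ) 1 ×ˢ Metric.closedBall (0 : ℂ) R)
    · refine (isClosed_le continuous_const continuous_fst).inter
        ((isClosed_le continuous_fst continuous_const).inter
          ((isClosed_le continuous_const (Complex.continuous_im.comp continuous_snd)).inter
            (isClosed_eq hFc continuous_const)))
    · rintro ⟨θ, w⟩ ⟨h0, h1, h2, h3⟩
      exact ⟨⟨h0, h1⟩, by simpa using hR θ h0 h1 w h3⟩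
  have hSne : S.Nonempty := ⟨(1, z), zero_le_one, le_rfl, hz, by simpa [hF] using hzero⟩
  obtain ⟨⟨θ, w⟩, ⟨h0, h1, hw, hFw⟩, hmin⟩ := hScomp.exists_isMinOn hSne continuous_fst.continuousOn
  simp only at h0 h1 hw hFw
  have hθ : 0 < θ := by
    refine h0.lt_of_ne fun h => hstart w hw ?_
    simpa [hF, ← h] using hFw
  have hwpos : 0 < w.im := by
    refine hw.lt_of_ne fun h => hreal θ h0 h1 w.re ?_
    have : ((w.re : ℝ) : ℂ) = w := Complex.ext (by simp) (by simpa using h)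
    rw [this]; exact hFw
  have hbound : ∀ η : ℝ, 0 ≤ η → F θ (w + η * Complex.I) = 0 := by
    intro η hη
    set K : ℝ := (w.im + η) / w.im with hK
    have hcl : ∀ θ' ∈ Set.Ico 0 θ, ‖F θ' (w + η * Complex.I)‖ ≤ K ^ d * ‖F θ' w‖ := by
      rintro θ' ⟨h0', h1'⟩
      have hroot : ∀ ρ : ℂ, F θ' ρ = 0 → ρ.im < 0 := by
        intro ρ hρ
        by_contra hc'
        have : θ ≤ θ' := hmin (a := (θ', ρ)) ⟨h0', by linarith, not_lt.1 hc', hρ⟩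
        linarith
      have h2 := Polynomial.norm_eval_le_of_roots (linePoly h (V + (θ' : ℂ) • U) c) (z := w)
        (w := w + η * Complex.I) (K := K) ?_ ?_ (natDegree_linePoly_le h hh.totalDegree_le _ _)
      · simpa only [eval_linePoly] using h2
      · intro ρ hρ
        rw [eval_linePoly] at hρ
        have h3 := hroot ρ hρ
        have h4 : w.im ≤ ‖w - ρ‖ := by
          have := (le_abs_self _).trans (Complex.abs_im_le_norm (w - ρ))
          rw [Complex.sub_im] at this
          linarith
        have h5 : ‖w + η * Complex.I - ρ‖ ≤ ‖w - ρ‖ + η := by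
          have : w + η * Complex.I - ρ = (w - ρ) + η * Complex.I := by ring
          rw [this]
          refine (norm_add_le _ _).trans ?_
          simp [abs_of_nonneg hη]
        refine h5.trans ?_
        rw [hK, div_mul_eq_mul_div, le_div_iff₀ hwpos]
        nlinarith
      · rw [hK, le_div_iff₀ hwpos]; linarith
    have hclosed : IsClosed {θ' : ℝ | ‖F θ' (w + η * Complex.I)‖ ≤ K ^ d * ‖F θ' w‖} := by
      refine isClosed_le ?_ ?_
      · exact (hFc.comp (by fun_prop : Continuous fun θ' : ℝ => (θ', w + η * Complex.I))).norm
      · exact continuous_const.mul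
          (hFc.comp (by fun_prop : Continuous fun θ' : ℝ => (θ', w))).norm
    have hmem := hclosed.closure_subset_iff.2 hcl
    rw [closure_Ico hθ.ne] at hmem
    have h6 := hmem (Set.right_mem_Icc.2 hθ.le)
    simp only [Set.mem_ofPred_eq, hFw, norm_zero, mul_zero] at h6
    exact norm_le_zero_iff.1 h6
  have h7 := hR θ h0 h1 _ (hbound (|R| + 1) (by positivity))
  have h8 := (le_abs_self _).trans (Complex.abs_im_le_norm (w + ((|R| + 1 : ℝ) : ℂ) * Complex.I))
  simp only [Complex.add_im, Complex.mul_im, Complex.ofReal_re, Complex.I_im, mul_one,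
    Complex.ofReal_im, Complex.I_re, mul_zero, add_zero] at h8
  have := le_abs_self R
  linarith
/-- Complex directions along which `h` does not vanish over the upper half plane of `e`. -/
def StableDirection (h : MvPolynomial (Fin m) ℝ) (e : Fin m → ℝ) (U : Fin m → ℂ) : Prop :=
  ∀ (u : Fin m → ℝ) (s : ℝ) (x : ℂ), 0 ≤ s → 0 < x.im →
    aeval (complexify u + (s : ℂ) • U + x • complexify e) h ≠ 0

lemma IsHyperbolic.stableDirection_zero (hh : IsHyperbolic h e lam) : StableDirection h e 0 := by
  intro u s x _ hx
  rw [smul_zero, add_zero]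
  exact hh.aeval_real_add_ne_zero u hx

lemma StableDirection.add_smul (hh : IsHyperbolic h e lam) {U : Fin m → ℂ}
    (hU : StableDirection h e U) {c : Fin m → ℝ} (hc : MemCone h e c) {z : ℂ} (hz : 0 ≤ z.im) :
    StableDirection h e (U + z • complexify c) := by
  intro u s x hs hx
  obtain ⟨ε, hε, hεx⟩ : ∃ ε : ℝ, 0 < ε ∧ 0 < (x - (s * ε : ℝ) * z).im := by
    refine ⟨x.im / (2 * (s * z.im + 1)), by positivity, ?_⟩
    rw [Complex.sub_im, Complex.im_ofReal_mul]
    have h1 : 0 < s * z.im + 1 := by positivity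
    have h2 : s * (x.im / (2 * (s * z.im + 1))) * z.im =
        x.im * ((s * z.im) / (2 * (s * z.im + 1))) := by field_simp
    have h3 : (s * z.im) / (2 * (s * z.im + 1)) < 1 := by
      rw [div_lt_one (by positivity)]
      have : 0 ≤ s * z.im := by positivity
      linarith
    rw [h2]
    nlinarith
  set x' : ℂ := x - (s * ε : ℝ) * z with hx'
  have hc' : aeval (complexify (c + ε • e)) h ≠ 0 := by
    rw [aeval_complexify, add_comm]
    exact_mod_cast hc ε hε
  have hmain := aeval_ne_zero_of_homotopy hh.1 (x' • complexify e)
    (complexify u + (s : ℂ) • U) (complexify (c + ε • e)) hc' ?_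
    (fun w hw => hh.aeval_smul_add_smul_ne_zero hc hε.le hεx hw) ((s : ℂ) * z) ?_
  · convert! hmain using 2
    ext j
    simp [complexify, hx']
    ring
  · intro θ h0 _ t
    have := hU (θ • u + t • (c + ε • e)) (θ * s) x' (by positivity) hεx
    convert! this using 2
    ext j
    simp [complexify]
    ring
  · rw [Complex.im_ofReal_mul]; positivity

lemma IsHyperbolic.stableDirection_sum (hh : IsHyperbolic h e lam) {ι : Type*} (s : Finset ι)
    (c : ι → Fin m → ℝ) (z : ι → ℂ) (hc : ∀ i ∈ s, MemCone h e (c i))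
    (hz : ∀ i ∈ s, 0 ≤ (z i).im) :
    StableDirection h e (∑ i ∈ s, z i • complexify (c i)) := by
  induction s using Finset.induction_on with
  | empty => simpa using hh.stableDirection_zero
  | insert a s ha ih =>
    rw [Finset.sum_insert ha, add_comm]
    exact (ih (fun i hi => hc i (Finset.mem_insert_of_mem hi))
      (fun i hi => hz i (Finset.mem_insert_of_mem hi))).add_smul hh
      (hc a (Finset.mem_insert_self a s)) (hz a (Finset.mem_insert_self a s))

lemma IsHyperbolic.aeval_sum_ne_zero (hh : IsHyperbolic h e lam) {ι : Type*} (s : Finset ι)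
    (c : ι → Fin m → ℝ) (z : ι → ℂ) (hc : ∀ i ∈ s, MemCone h e (c i))
    (hz : ∀ i ∈ s, 0 ≤ (z i).im) {x : ℂ} (hx : 0 < x.im) :
    aeval (x • complexify e + ∑ i ∈ s, z i • complexify (c i)) h ≠ 0 := by
  have := hh.stableDirection_sum s c z hc hz 0 1 x zero_le_one hx
  have h1 : complexify (0 : Fin m → ℝ) = 0 := by ext j; simp [complexify]
  rwa [h1, zero_add, Complex.ofReal_one, one_smul, add_comm] at this

lemma IsHyperbolic.memCone_sum (hh : IsHyperbolic h e lam) {ι : Type*} (s : Finset ι)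
    (c : ι → Fin m → ℝ) (hc : ∀ i ∈ s, MemCone h e (c i)) : MemCone h e (∑ i ∈ s, c i) := by
  intro t ht h0
  have := hh.aeval_sum_ne_zero s c (fun _ => Complex.I) hc (by simp) (x := Complex.I * t)
    (by simpa using ht)
  refine this ?_
  have h1 : (Complex.I * t) • complexify e + ∑ i ∈ s, Complex.I • complexify (c i) =
      Complex.I • complexify (t • e + ∑ i ∈ s, c i) := by
    rw [← Finset.smul_sum, mul_smul, ← smul_add]
    congr 1
    ext j
    simp [complexify]
  rw [h1, hh.1.aeval_smul, aeval_complexify, h0]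
  simp

lemma MemCone.add (hh : IsHyperbolic h e lam) {b c : Fin m → ℝ} (hb : MemCone h e b)
    (hc : MemCone h e c) : MemCone h e (b + c) := by
  have := hh.memCone_sum Finset.univ ![b, c] (by
    intro i _; fin_cases i <;> simpa)
  simpa using this

/-- Monotonicity of `h` on its hyperbolicity cone. -/
lemma IsHyperbolic.abs_eval_le_abs_eval_add (hh : IsHyperbolic h e lam) {a b : Fin m → ℝ}
    (ha : MemCone h e a) (hb : MemCone h e b) :
    |eval (e + a) h| ≤ |eval (e + a + b) h| := by
  have h1 := Polynomial.norm_eval_le_of_roots (linePoly h (complexify (e + a)) (complexify b))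
    (z := 1) (w := 0) (K := 1) ?_ le_rfl (natDegree_linePoly_le h hh.1.totalDegree_le _ _)
  · have h2 : complexify (e + a) + complexify b = complexify (e + a + b) := by
      ext j; simp [complexify]
    simpa only [eval_linePoly, zero_smul, add_zero, one_smul, h2, aeval_complexify,
      Complex.norm_real, Real.norm_eq_abs, one_pow, one_mul] using h1
  · intro ρ hρ
    have hre : ρ.re ≤ 0 := by
      by_contra hc
      rw [eval_linePoly] at hρ
      have := hh.aeval_sum_ne_zero Finset.univ ![a, b] ![Complex.I, Complex.I * ρ] (by
        intro i _; fin_cases i <;> simpa) (by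
        intro i _; fin_cases i <;> simp; linarith) (x := Complex.I) (by simp)
      refine this ?_
      have h1 : Complex.I • complexify e + ∑ i, ![Complex.I, Complex.I * ρ] i •
          complexify (![a, b] i) = Complex.I • (complexify (e + a) + ρ • complexify b) := by
        ext j
        simp [complexify]
        ring
      rw [h1, hh.1.aeval_smul, hρ, mul_zero]
    rw [zero_sub, norm_neg, one_mul, Complex.norm_def, Complex.norm_def]
    apply Real.sqrt_le_sqrt
    simp only [Complex.normSq_apply, Complex.sub_re, Complex.sub_im, Complex.one_re,
      Complex.one_im]
    nlinarith

/-- Along a direction of hyperbolic rank at most one the polynomial is affine, at points far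
inside the cone. -/
lemma IsHyperbolic.natDegree_linePoly_le_one (hh : IsHyperbolic h e lam) {w : Fin m → ℝ}
    (hw : InCone lam w) (hrk : hrank lam w ≤ 1) {y : Fin m → ℝ} (hy : MemCone h e (y - e)) :
    (linePoly h y w).natDegree ≤ 1 := by
  obtain ⟨X, hX⟩ := hh.exists_memCone_smul_add (-y)
  set q : Polynomial ℝ := Polynomial.C (eval e h) *
    ∏ i, (Polynomial.C X + Polynomial.X * Polynomial.C (lam w i)) with hq
  have hqdeg : q.natDegree ≤ 1 := by
    refine (Polynomial.natDegree_C_mul_le _ _).trans ((Polynomial.natDegree_prod_le _ _).trans ?_)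
    have h1 : ∀ i, (Polynomial.C X + Polynomial.X * Polynomial.C (lam w i)).natDegree ≤
        if lam w i ≠ 0 then 1 else 0 := by
      intro i
      split_ifs with hi
      · compute_degree
      · rw [not_not.1 hi]; simp
    refine (Finset.sum_le_sum fun i _ => h1 i).trans ?_
    rw [Finset.sum_boole, Nat.cast_id]
    rw [hrank, Nat.card_eq_fintype_card, Fintype.card_subtype] at hrk
    exact hrk
  have hbound : ∀ t : ℝ, 0 < t → |(linePoly h y w).eval t| ≤ |q.eval t| := by
    intro t ht
    have h1 := hh.abs_eval_le_abs_eval_add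
      (hy.add hh ((hh.memCone_of_inCone hw).smul hh.1 ht)) (hX X le_rfl)
    have h2 : e + (y - e + t • w) = y + t • w := by abel
    have h3 : y + t • w + (X • e + -y) = X • e - (-t) • w := by rw [neg_smul]; abel
    rw [h2, h3, hh.eval_smul_sub_smul w (neg_ne_zero.2 ht.ne')] at h1
    rw [eval_linePoly, MvPolynomial.aeval_eq_eval]
    refine h1.trans_eq ?_
    simp only [hq, Polynomial.eval_prod, Polynomial.eval_mul, Polynomial.eval_add,
      Polynomial.eval_C, Polynomial.eval_X, neg_mul, sub_neg_eq_add]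
  by_contra hlt
  rw [not_le] at hlt
  have hp0 : linePoly h y w ≠ 0 := by rintro h0; simp [h0] at hlt
  by_cases hq0 : q = 0
  · refine hp0 (Polynomial.eq_zero_of_infinite_isRoot _ ?_)
    refine (Set.Ioi_infinite (0 : ℝ)).mono fun t ht => ?_
    have := hbound t ht
    rw [hq0, Polynomial.eval_zero, abs_zero] at this
    exact abs_nonpos_iff.1 this
  · have hdeg : q.degree < (linePoly h y w).degree :=
      Polynomial.degree_lt_degree (by omega)
    have h1 := Polynomial.abs_div_tendsto_atTop_atTop_of_degree_gt _ _ hdeg hq0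
    have h2 := (h1.eventually_gt_atTop 1).and (Filter.eventually_gt_atTop 0)
    obtain ⟨t, h3, h4⟩ := h2.exists
    rw [abs_div] at h3
    have h5 := div_le_one_of_le₀ (hbound t h4) (abs_nonneg _)
    linarith

end Cone
/-! ### Stable polynomials and the operators `1 - ∂² / 2` -/

section Stable

variable {n : ℕ}

/-- Nonvanishing when the first variable lies in the open upper half plane and the other ones in
the closed upper half plane. -/
def IsStable (Q : MvPolynomial (Fin (n + 1)) ℝ) : Prop :=
  ∀ V : Fin (n + 1) → ℂ, 0 < (V 0).im → (∀ i : Fin n, 0 ≤ (V i.succ).im) → aeval V Q ≠ 0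

lemma IsStable.aeval_add_single_ne_zero {Q : MvPolynomial (Fin (n + 1)) ℝ} (hQ : IsStable Q)
    {V : Fin (n + 1) → ℂ} (h0 : 0 < (V 0).im) (hV : ∀ i : Fin n, 0 ≤ (V i.succ).im)
    (i : Fin n) {s : ℂ} (hs : 0 ≤ s.im) : aeval (V + s • Pi.single i.succ 1) Q ≠ 0 := by
  refine hQ _ ?_ fun j => ?_
  · have : (Pi.single i.succ 1 : Fin (n + 1) → ℂ) 0 = 0 :=
      Pi.single_eq_of_ne (Fin.succ_ne_zero i).symm _
    simpa [this] using h0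
  · have := hV j
    by_cases hij : j = i
    · subst hij; simp; linarith
    · have h1 : (Pi.single i.succ 1 : Fin (n + 1) → ℂ) j.succ = 0 :=
        Pi.single_eq_of_ne (fun h => hij (Fin.succ_injective _ h)) _
      simpa [h1] using this

/-- The operator `1 - ∂² / 2` in the direction `i`. -/
def opOne (i : Fin n) (Q : MvPolynomial (Fin (n + 1)) ℝ) : MvPolynomial (Fin (n + 1)) ℝ :=
  Q - C (1 / 2 : ℝ) * pderiv i.succ (pderiv i.succ Q)

lemma aeval_opOne {K : Type*} [Field K] [Algebra ℝ K] (i : Fin n)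
    (Q : MvPolynomial (Fin (n + 1)) ℝ) (V : Fin (n + 1) → K) :
    aeval V (opOne i Q) = aeval V Q - 1 / 2 * aeval V (pderiv i.succ (pderiv i.succ Q)) := by
  simp [opOne]
  left
  exact map_ofNat (algebraMap ℝ K) 2

lemma pderiv_opOne (i : Fin n) (k : Fin (n + 1)) (Q : MvPolynomial (Fin (n + 1)) ℝ) :
    pderiv k (opOne i Q) = opOne i (pderiv k Q) := by
  simp only [opOne, map_sub, pderiv_C_mul]
  rw [MvPolynomial.pderiv_pderiv_comm k, MvPolynomial.pderiv_pderiv_comm k]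

/-- Degree at most two in each of the variables but the first. -/
def IsCubicFree (Q : MvPolynomial (Fin (n + 1)) ℝ) : Prop :=
  ∀ i : Fin n, pderiv i.succ (pderiv i.succ (pderiv i.succ Q)) = 0

lemma IsCubicFree.pderiv {Q : MvPolynomial (Fin (n + 1)) ℝ} (hQ : IsCubicFree Q)
    (k : Fin (n + 1)) : IsCubicFree (pderiv k Q) := by
  intro i
  rw [MvPolynomial.pderiv_pderiv_comm _ k, MvPolynomial.pderiv_pderiv_comm _ k,
    MvPolynomial.pderiv_pderiv_comm _ k, hQ i, map_zero]

lemma IsCubicFree.opOne {Q : MvPolynomial (Fin (n + 1)) ℝ} (hQ : IsCubicFree Q) (i : Fin n) :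
    IsCubicFree (opOne i Q) := by
  intro k
  rw [pderiv_opOne, pderiv_opOne, pderiv_opOne, hQ k]
  simp [_root_.opOne]

lemma IsStable.opOne {Q : MvPolynomial (Fin (n + 1)) ℝ} (hQ : IsStable Q) (hc : IsCubicFree Q)
    (i : Fin n) : IsStable (opOne i Q) := by
  intro V h0 hV hzero
  rw [aeval_opOne] at hzero
  set q0 := aeval V Q with hq0
  set q1 := aeval V (MvPolynomial.pderiv i.succ Q) with hq1
  set q2 := 1 / 2 * aeval V (MvPolynomial.pderiv i.succ (MvPolynomial.pderiv i.succ Q)) with hq2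
  have hq0ne : q0 ≠ 0 := hQ V h0 hV
  have hq : q2 = q0 := (sub_eq_zero.1 hzero).symm
  have hno : ∀ s : ℂ, 0 ≤ s.im → q0 + s * q1 + s ^ 2 * q0 ≠ 0 := by
    intro s hs
    have := hQ.aeval_add_single_ne_zero h0 hV i hs
    rwa [aeval_add_single_of_cubic Q i.succ (hc i), ← hq0, ← hq1, ← hq2, hq] at this
  obtain ⟨s, hs⟩ := exists_quadratic_eq_zero (a := q0) (b := q1) (c := q0) hq0ne
    (IsAlgClosed.exists_eq_mul_self _)
  have hs0 : s ≠ 0 := by rintro rfl; simp at hs; exact hq0ne hs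
  rcases le_total 0 s.im with him | him
  · exact hno s him (by linear_combination hs)
  · refine hno s⁻¹ ?_ ?_
    · rw [Complex.inv_im]
      exact div_nonneg (by linarith) (Complex.normSq_nonneg _)
    · field_simp
      linear_combination hs

lemma IsStable.im_pderiv_mul_conj_nonpos {Q : MvPolynomial (Fin (n + 1)) ℝ} (hQ : IsStable Q)
    (a : Fin (n + 1) → ℝ) (i j : Fin n) {s : ℂ} (hs : 0 ≤ s.im) :
    (aeval (complexify a + s • Pi.single i.succ 1) (pderiv j.succ Q) *
      (starRingEnd ℂ) (aeval (complexify a + s • Pi.single i.succ 1) Q)).im ≤ 0 := by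
  set V : ℝ → Fin (n + 1) → ℂ := fun ε =>
    complexify a + (ε * Complex.I) • Pi.single 0 1 + s • Pi.single i.succ 1 with hV
  have hpos : ∀ ε : ℝ, 0 < ε → (aeval (V ε) (pderiv j.succ Q) *
      (starRingEnd ℂ) (aeval (V ε) Q)).im ≤ 0 := by
    intro ε hε
    have h1 := Polynomial.im_derivative_mul_conj_nonpos (linePoly Q (V ε) (Pi.single j.succ 1)) ?_
    · simpa only [derivative_linePoly_single, eval_linePoly, zero_smul, add_zero] using h1
    · intro z hz
      rw [eval_linePoly]
      refine hQ.aeval_add_single_ne_zero ?_ (fun k => ?_) j hz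
      · simp [hV, complexify, hε]
      · by_cases hik : k = i
        · subst hik; simp [hV, complexify, hs]
        · have h1 : (Pi.single i.succ 1 : Fin (n + 1) → ℂ) k.succ = 0 :=
            Pi.single_eq_of_ne (fun h => hik (Fin.succ_injective _ h)) _
          simp [hV, complexify, h1]
  have hcont : Continuous fun ε : ℝ => (aeval (V ε) (pderiv j.succ Q) *
      (starRingEnd ℂ) (aeval (V ε) Q)).im := by
    have hVc : Continuous V := by fun_prop
    exact Complex.continuous_im.comp (((continuous_aeval_complex _).comp hVc).mul
      (Complex.continuous_conj.comp ((continuous_aeval_complex _).comp hVc)))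
  have hlim := hcont.continuousWithinAt (s := Set.Ioi (0 : ℝ)) (x := 0)
  have := le_of_tendsto hlim (by
    filter_upwards [self_mem_nhdsWithin] with ε hε using hpos ε hε)
  simpa [hV] using this

lemma eval_add_single {Q : MvPolynomial (Fin (n + 1)) ℝ} (hc : IsCubicFree Q) (i : Fin n)
    (a : Fin (n + 1) → ℝ) (s : ℝ) :
    eval (a + s • Pi.single i.succ 1) Q = eval a Q + s * eval a (pderiv i.succ Q) +
      s ^ 2 * (1 / 2 * eval a (pderiv i.succ (pderiv i.succ Q))) := by
  simpa only [MvPolynomial.aeval_eq_eval] using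
    aeval_add_single_of_cubic (K := ℝ) Q i.succ (hc i) a s

/-- The Rayleigh inequality, in terms of the Taylor coefficients in the direction `i`. -/
lemma IsStable.rayleigh {Q : MvPolynomial (Fin (n + 1)) ℝ} (hQ : IsStable Q)
    (hc : IsCubicFree Q) (a : Fin (n + 1) → ℝ) (i j : Fin n) {q0 q1 q2 p0 p1 p2 : ℝ}
    (hq0 : q0 = eval a Q) (hq1 : q1 = eval a (pderiv i.succ Q))
    (hq2 : q2 = 1 / 2 * eval a (pderiv i.succ (pderiv i.succ Q)))
    (hp0 : p0 = eval a (pderiv j.succ Q))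
    (hp1 : p1 = eval a (pderiv i.succ (pderiv j.succ Q)))
    (hp2 : p2 = 1 / 2 * eval a (pderiv i.succ (pderiv i.succ (pderiv j.succ Q)))) (x : ℝ) :
    (p1 * q0 - p0 * q1) + 2 * (p2 * q0 - p0 * q2) * x + (q1 * p2 - q2 * p1) * x ^ 2 ≤ 0 := by
  have hpos : ∀ y : ℝ, 0 < y → (p1 * q0 - p0 * q1) + 2 * (p2 * q0 - p0 * q2) * x +
      (q1 * p2 - q2 * p1) * (x ^ 2 + y ^ 2) ≤ 0 := by
    intro y hy
    have h1 := hQ.im_pderiv_mul_conj_nonpos a i j (s := x + y * Complex.I) (by simpa using hy.le)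
    rw [aeval_add_single_of_cubic Q i.succ (hc i),
      aeval_add_single_of_cubic _ i.succ (hc.pderiv j.succ i)] at h1
    simp only [aeval_complexify] at h1
    have e2 : (1 / 2 : ℂ) * ((eval a (pderiv i.succ (pderiv i.succ Q)) : ℝ) : ℂ) = (q2 : ℂ) := by
      rw [hq2]; push_cast; ring
    have e3 : (1 / 2 : ℂ) * ((eval a (pderiv i.succ (pderiv i.succ (pderiv j.succ Q))) : ℝ) : ℂ)
        = (p2 : ℂ) := by
      rw [hp2]; push_cast; ring
    rw [e2, e3, ← hq0, ← hq1, ← hp0, ← hp1] at h1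
    simp [pow_two] at h1
    have h2 : y * ((p1 * q0 - p0 * q1) + 2 * (p2 * q0 - p0 * q2) * x +
      (q1 * p2 - q2 * p1) * (x ^ 2 + y ^ 2)) ≤ 0 := by nlinarith only [h1]
    by_contra hcon
    have := mul_pos hy (not_le.1 hcon)
    linarith
  have hcont : Continuous fun y : ℝ => (p1 * q0 - p0 * q1) + 2 * (p2 * q0 - p0 * q2) * x +
      (q1 * p2 - q2 * p1) * (x ^ 2 + y ^ 2) := by fun_prop
  have hlim := hcont.continuousWithinAt (s := Set.Ioi (0 : ℝ)) (x := 0)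
  have := le_of_tendsto hlim (by
    filter_upwards [self_mem_nhdsWithin] with ε hε using hpos ε hε)
  simpa using this

lemma quadratic_coeff_nonneg {q0 q1 q2 : ℝ} (hdisc : 4 * q0 * q2 ≤ q1 ^ 2)
    (hpos : ∀ s : ℝ, 0 ≤ s → 0 < q0 + s * q1 + s ^ 2 * q2) : 0 ≤ q1 ∧ 0 ≤ q2 := by
  have h0 : 0 < q0 := by simpa using hpos 0 le_rfl
  have h2 : 0 ≤ q2 := by
    by_contra hneg
    have hM : 0 < -q2 := by linarith
    have h3 : 0 ≤ (|q1| + q0) / -q2 := by positivity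
    have h1 := hpos (1 + (|q1| + q0) / -q2) (by linarith)
    set s := 1 + (|q1| + q0) / -q2 with hs
    have h4 : s * -q2 = -q2 + (|q1| + q0) := by
      rw [hs, add_mul, one_mul, div_mul_cancel₀ _ hM.ne']
    have h5 : 1 ≤ s := by linarith
    have h6 := le_abs_self q1
    have h7 : s ^ 2 * q2 = -(s * (-q2 + (|q1| + q0))) := by rw [← h4]; ring
    nlinarith
  refine ⟨?_, h2⟩
  by_contra hneg
  rw [not_le] at hneg
  rcases h2.eq_or_lt with h2 | h2
  · have h1 := hpos (q0 / -q1) (div_nonneg h0.le (by linarith))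
    rw [← h2] at h1
    have : q0 / -q1 * q1 = -q0 := by
      have := hneg.ne
      field_simp
    linarith
  · have h1 := hpos (-q1 / (2 * q2)) (div_nonneg (by linarith) (by linarith))
    have h3 : q0 + -q1 / (2 * q2) * q1 + (-q1 / (2 * q2)) ^ 2 * q2 =
        (4 * q0 * q2 - q1 ^ 2) / (4 * q2) := by
      field_simp
      ring
    rw [h3] at h1
    have := div_nonpos_of_nonpos_of_nonneg (sub_nonpos.2 hdisc) (by linarith : 0 ≤ 4 * q2)
    linarith

lemma discrim_of_rayleigh {q0 q1 q2 : ℝ}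
    (hr : ∀ x : ℝ, (2 * q2 * q0 - q1 * q1) + 2 * (0 * q0 - q1 * q2) * x +
      (q1 * 0 - q2 * (2 * q2)) * x ^ 2 ≤ 0) : 4 * q0 * q2 ≤ q1 ^ 2 := by
  by_cases h : q2 = 0
  · rw [h]; nlinarith [sq_nonneg q1]
  · have h1 := hr (-q1 / (2 * q2))
    have h2 : (2 * q2 * q0 - q1 * q1) + 2 * (0 * q0 - q1 * q2) * (-q1 / (2 * q2)) +
      (q1 * 0 - q2 * (2 * q2)) * (-q1 / (2 * q2)) ^ 2 = (4 * q0 * q2 - q1 ^ 2) / 2 := by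
      field_simp
      ring
    rw [h2] at h1
    linarith

/-- One step of the barrier argument, for quadratic polynomials. -/
lemma barrier_step {q0 q1 q2 p0 p1 p2 α : ℝ} (h0 : 0 < q0) (h1 : 0 ≤ q1) (h2 : 0 ≤ q2)
    (hα : q1 ≤ α * q0) (hα1 : α ≤ 1) (hdisc : 4 * q0 * q2 ≤ q1 ^ 2)
    (hr : ∀ x : ℝ, (p1 * q0 - p0 * q1) + 2 * (p2 * q0 - p0 * q2) * x +
      (q1 * p2 - q2 * p1) * x ^ 2 ≤ 0) :
    0 < q0 + 2 * α * q1 + ((2 * α) ^ 2 - 1) * q2 ∧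
      (p0 + 2 * α * p1 + ((2 * α) ^ 2 - 1) * p2) * q0 ≤
        p0 * (q0 + 2 * α * q1 + ((2 * α) ^ 2 - 1) * q2) := by
  have hα0 : 0 ≤ α := by
    by_contra hneg
    nlinarith
  have hq1 : q1 ≤ q0 := by nlinarith
  have hq2 : 4 * q2 ≤ q0 := by nlinarith
  constructor
  · have : 0 ≤ 2 * α * q1 := by positivity
    have : 0 ≤ (2 * α) ^ 2 * q2 := by positivity
    nlinarith
  obtain ⟨A, hA⟩ : ∃ A, A = p1 * q0 - p0 * q1 := ⟨_, rfl⟩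
  obtain ⟨B, hB⟩ : ∃ B, B = p2 * q0 - p0 * q2 := ⟨_, rfl⟩
  have hE : q0 * (q1 * p2 - q2 * p1) = q1 * B - q2 * A := by rw [hA, hB]; ring
  have hr' : ∀ x : ℝ, A * (q0 - q2 * x ^ 2) + B * (2 * q0 * x + q1 * x ^ 2) ≤ 0 := by
    intro x
    have := mul_nonpos_of_nonneg_of_nonpos h0.le (hr x)
    rw [← hA, ← hB] at this
    have h3 : q0 * (A + 2 * B * x + (q1 * p2 - q2 * p1) * x ^ 2) =
        A * (q0 - q2 * x ^ 2) + B * (2 * q0 * x + q1 * x ^ 2) := by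
      linear_combination x ^ 2 * hE
    linarith
  suffices hgoal : 2 * α * A + ((2 * α) ^ 2 - 1) * B ≤ 0 by
    rw [hA, hB] at hgoal
    linarith
  have hA0 : A ≤ 0 := by
    have := hr' 0
    by_contra hneg
    have := mul_pos (not_le.1 hneg) h0
    linarith
  have hB0 : B ≤ 0 := by
    by_contra hneg
    rw [not_le] at hneg
    have h3 := hr' (-A / B)
    have h4 : 0 ≤ -A / B := div_nonneg (by linarith) hneg.le
    set x := -A / B with hx
    have h5 : B * x = -A := by rw [hx]; field_simp
    have h6 := hr' (x + 1)
    have h7 : 0 ≤ -A * q2 * (x + 1) ^ 2 :=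
      mul_nonneg (mul_nonneg (by linarith) h2) (sq_nonneg _)
    have h8 : 0 ≤ B * q1 * (x + 1) ^ 2 := by positivity
    have h9 : B * (2 * q0 * (x + 1)) = -2 * A * q0 + 2 * B * q0 := by
      linear_combination 2 * q0 * h5
    have h10 : 0 < B * q0 := mul_pos hneg h0
    have h11 : 0 ≤ -A * q0 := mul_nonneg (by linarith) h0.le
    nlinarith
  rcases le_or_gt 1 ((2 * α) ^ 2) with hδ | hδ
  · have := mul_nonpos_of_nonneg_of_nonpos (sub_nonneg.2 hδ) hB0
    have := mul_nonpos_of_nonneg_of_nonpos (by positivity : 0 ≤ 2 * α) hA0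
    linarith
  have hAB : A * q1 ≤ B * q0 := by
    rcases h1.eq_or_lt with h1 | h1
    · have hq2' : q2 = 0 := by rw [← h1] at hdisc; nlinarith
      have hBz : B = 0 := by
        by_contra hne
        have h3 := hr' ((1 - A) / (2 * B))
        rw [hq2', ← h1] at h3
        have h4 : A * (q0 - 0 * ((1 - A) / (2 * B)) ^ 2) +
            B * (2 * q0 * ((1 - A) / (2 * B)) + 0 * ((1 - A) / (2 * B)) ^ 2) = q0 := by
          field_simp
          ring
        linarith
      rw [← h1, hBz]; simp
    · have h3 := hr' (-(q0 / q1))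
      have h4 : A * (q0 - q2 * (-(q0 / q1)) ^ 2) +
          B * (2 * q0 * -(q0 / q1) + q1 * (-(q0 / q1)) ^ 2) =
          (A * q1 - B * q0 - A * q0 * (q2 / q1)) * (q0 / q1) := by
        field_simp
        ring
      rw [h4] at h3
      have h5 : 0 < q0 / q1 := div_pos h0 h1
      have h6 : A * q1 - B * q0 - A * q0 * (q2 / q1) ≤ 0 := by
        by_contra hneg
        have := mul_pos (not_le.1 hneg) h5
        linarith
      have h7 : 0 ≤ -A * q0 * (q2 / q1) :=
        mul_nonneg (mul_nonneg (by linarith) h0.le) (div_nonneg h2 h1.le)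
      linarith
  have hAα : A * α ≤ B := by
    have h3 : A * (α * q0) ≤ A * q1 := mul_le_mul_of_nonpos_left hα hA0
    have h4 : A * α * q0 ≤ B * q0 := by linarith
    exact le_of_mul_le_mul_right h4 h0
  have h5 : (1 - (2 * α) ^ 2) * (A * α) ≤ (1 - (2 * α) ^ 2) * B :=
    mul_le_mul_of_nonneg_left hAα (by linarith)
  have h6 : A * α ≤ 0 := mul_nonpos_of_nonpos_of_nonneg hA0 hα0
  nlinarith [mul_nonneg (sq_nonneg α) (neg_nonneg.2 h6)]

lemma eval_foldl_opOne_pos (α : Fin n → ℝ) (hα : ∀ i, α i ≤ 1) (l : List (Fin n)) :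
    ∀ (Q : MvPolynomial (Fin (n + 1)) ℝ) (a : Fin (n + 1) → ℝ), IsStable Q → IsCubicFree Q →
      (∀ t : Fin (n + 1) → ℝ, (∀ k, 0 ≤ t k) → 0 < eval (a + t) Q ∧
        ∀ i, eval (a + t) (pderiv i.succ Q) ≤ α i * eval (a + t) Q) →
      ∀ t : Fin (n + 1) → ℝ, (∀ k, 0 ≤ t k) →
        0 < eval (a + (l.map fun i => (2 * α i) • (Pi.single i.succ 1 : Fin (n + 1) → ℝ)).sum + t)
          (l.foldl (fun Q i => opOne i Q) Q) := by
  induction l with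
  | nil =>
    intro Q a _ _ hI t ht
    simpa using (hI t ht).1
  | cons i l ih =>
    intro Q a hs hc hI t ht
    have hstep : ∀ t : Fin (n + 1) → ℝ, (∀ k, 0 ≤ t k) →
        0 < eval (a + (2 * α i) • Pi.single i.succ 1 + t) (opOne i Q) ∧
        ∀ j, eval (a + (2 * α i) • Pi.single i.succ 1 + t) (pderiv j.succ (opOne i Q)) ≤
          α j * eval (a + (2 * α i) • Pi.single i.succ 1 + t) (opOne i Q) := by
      intro t ht
      obtain ⟨hpos, hbd⟩ := hI t ht
      set b := a + t with hb
      have hbt : a + (2 * α i) • (Pi.single i.succ 1 : Fin (n + 1) → ℝ) + t =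
          b + (2 * α i) • Pi.single i.succ 1 := by rw [hb]; abel
      rw [hbt]
      have hop : ∀ P : MvPolynomial (Fin (n + 1)) ℝ, IsCubicFree P →
          eval (b + (2 * α i) • Pi.single i.succ 1) (opOne i P) =
          eval b P + 2 * α i * eval b (pderiv i.succ P) +
          ((2 * α i) ^ 2 - 1) * (1 / 2 * eval b (pderiv i.succ (pderiv i.succ P))) := by
        intro P hP
        have h1 := aeval_opOne (K := ℝ) i P (b + (2 * α i) • Pi.single i.succ 1)
        simp only [MvPolynomial.aeval_eq_eval] at h1
        rw [h1, eval_add_single hP, eval_add_single (hP.pderiv _ |>.pderiv _), hP i]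
        simp only [map_zero]
        ring
      have hdisc : 4 * eval b Q * (1 / 2 * eval b (pderiv i.succ (pderiv i.succ Q))) ≤
          eval b (pderiv i.succ Q) ^ 2 := by
        refine discrim_of_rayleigh fun x => ?_
        refine hs.rayleigh hc b i i rfl rfl rfl rfl ?_ ?_ x
        · ring
        · rw [hc i]; simp
      obtain ⟨h1, h2⟩ := quadratic_coeff_nonneg hdisc fun s hs' => by
        rw [← eval_add_single hc]
        have := (hI (t + s • Pi.single i.succ 1) fun k => by
          have h3 : (0 : ℝ) ≤ (Pi.single i.succ 1 : Fin (n + 1) → ℝ) k := by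
            rw [Pi.single_apply]; split_ifs <;> norm_num
          exact add_nonneg (ht k) (mul_nonneg hs' h3)).1
        rwa [← add_assoc] at this
      have hall : ∀ j : Fin n, _ := fun j =>
        barrier_step hpos h1 h2 (hbd i) (hα i) hdisc (hs.rayleigh hc b i j rfl rfl rfl rfl rfl rfl)
      rw [hop Q hc]
      refine ⟨(hall i).1, fun j => ?_⟩
      rw [pderiv_opOne, hop _ (hc.pderiv _)]
      obtain ⟨hR, hR'⟩ := hall j
      refine le_of_mul_le_mul_right (hR'.trans ?_) hpos
      have := mul_le_mul_of_nonneg_right (hbd j) hR.le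
      linarith
    have := ih (opOne i Q) (a + (2 * α i) • Pi.single i.succ 1) (hs.opOne hc i) (hc.opOne i)
      hstep t ht
    simpa only [List.map_cons, List.sum_cons, List.foldl_cons, add_assoc] using this

end Stable
/-! ### The polynomial `h (x • e + ∑ i, z i • w i)` -/

section HPoly

variable {m d n : ℕ} {h : MvPolynomial (Fin m) ℝ} {e : Fin m → ℝ}
  {lam : (Fin m → ℝ) → Fin d → ℝ}

lemma aeval_hPoly {K : Type*} [Field K] [Algebra ℝ K] (w : Fin n → Fin m → ℝ)
    (V : Fin (n + 1) → K) :
    aeval V (hPoly h e w) = aeval (V 0 • (fun j => algebraMap ℝ K (e j)) +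
      ∑ i, V i.succ • (fun j => algebraMap ℝ K (w i j))) h := by
  rw [hPoly, ← AlgHom.comp_apply, MvPolynomial.comp_aeval]
  congr 2
  ext j
  simp [Finset.sum_apply]

lemma eval_hPoly (w : Fin n → Fin m → ℝ) (V : Fin (n + 1) → ℝ) :
    eval V (hPoly h e w) = eval (V 0 • e + ∑ i, V i.succ • w i) h := by
  have := aeval_hPoly (h := h) (e := e) w V
  rwa [MvPolynomial.aeval_eq_eval, MvPolynomial.aeval_eq_eval] at this

lemma IsHyperbolic.isStable_hPoly (hh : IsHyperbolic h e lam) {w : Fin n → Fin m → ℝ}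
    (hw : ∀ i, MemCone h e (w i)) : IsStable (hPoly h e w) := by
  intro V h0 hV
  rw [aeval_hPoly]
  exact hh.aeval_sum_ne_zero Finset.univ w (fun i => V i.succ) (fun i _ => hw i)
    (fun i _ => hV i) h0

lemma IsStable.sq {Q : MvPolynomial (Fin (n + 1)) ℝ} (hQ : IsStable Q) : IsStable (Q ^ 2) := by
  intro V h0 hV
  rw [map_pow]
  exact pow_ne_zero _ (hQ V h0 hV)

/-- Directions of rank at most one contribute degree at most one. -/
lemma IsHyperbolic.pderiv_pderiv_hPoly (hh : IsHyperbolic h e lam) (τ : Fin n → ℝ)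
    {v : Fin n → Fin m → ℝ} (hv : ∀ i, InCone lam (v i)) (hrk : ∀ i, hrank lam (v i) ≤ 1)
    (i : Fin n) :
    pderiv i.succ (pderiv i.succ (hPoly h e fun i => τ i • v i)) = 0 := by
  set P := hPoly h e fun i => τ i • v i with hP
  refine MvPolynomial.funext fun V => ?_
  obtain ⟨X, hX⟩ := hh.exists_memCone_smul_add
    ((V 0 - 1) • e + ∑ k : Fin n, V k.succ • (τ k • v k))
  have hzero : linePoly (pderiv i.succ (pderiv i.succ P)) V (Pi.single 0 1) = 0 := by
    refine Polynomial.eq_zero_of_infinite_isRoot _ ((Set.Ici_infinite X).mono fun x hx => ?_)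
    rw [Set.mem_ofPred_eq, Polynomial.IsRoot, eval_linePoly]
    set V' := V + x • (Pi.single 0 1 : Fin (n + 1) → ℝ) with hV'
    set y := V' 0 • e + ∑ k : Fin n, V' k.succ • (τ k • v k) with hy
    have hye : y - e = x • e + ((V 0 - 1) • e + ∑ k : Fin n, V k.succ • (τ k • v k)) := by
      have h1 : V' 0 = V 0 + x := by simp [hV']
      have h2 : ∀ k : Fin n, V' k.succ = V k.succ := fun k => by simp [hV']
      simp only [hy, h1, h2]
      module
    have hdeg := hh.natDegree_linePoly_le_one (hv i) (hrk i) (y := y) (by rw [hye]; exact hX x hx)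
    have hline : linePoly P V' (Pi.single i.succ 1) =
        (linePoly h y (v i)).comp (Polynomial.C (τ i) * Polynomial.X) := by
      refine Polynomial.funext fun s => ?_
      rw [eval_linePoly, Polynomial.eval_comp, eval_linePoly, MvPolynomial.aeval_eq_eval,
        MvPolynomial.aeval_eq_eval]
      simp only [hP, eval_hPoly]
      congr 2
      have h1 : (V' + s • (Pi.single i.succ 1 : Fin (n + 1) → ℝ)) 0 = V' 0 := by
        simp
      have h2 : ∀ k : Fin n, (V' + s • (Pi.single i.succ 1 : Fin (n + 1) → ℝ)) k.succ • (τ k • v k)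
          = V' k.succ • (τ k • v k) + if k = i then (s * τ i) • v i else 0 := by
        intro k
        by_cases hk : k = i
        · subst hk
          simp [smul_smul]
          module
        · simp [hk]
      rw [h1, Finset.sum_congr rfl fun k _ => h2 k, Finset.sum_add_distrib,
        Finset.sum_ite_eq' Finset.univ i, if_pos (Finset.mem_univ i), hy]
      simp only [Polynomial.eval_mul, Polynomial.eval_C, Polynomial.eval_X, mul_comm s, add_assoc]
    have hdeg2 : (linePoly P V' (Pi.single i.succ 1)).natDegree ≤ 1 := by
      rw [hline]
      refine Polynomial.natDegree_comp_le.trans ?_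
      exact Nat.mul_le_mul hdeg ((Polynomial.natDegree_C_mul_le _ _).trans
        Polynomial.natDegree_X_le)
    have hder : Polynomial.derivative (Polynomial.derivative
        (linePoly P V' (Pi.single i.succ 1))) = 0 := by
      rw [Polynomial.eq_X_add_C_of_natDegree_le_one hdeg2]
      simp
    rw [derivative_linePoly_single, derivative_linePoly_single] at hder
    have := congrArg (Polynomial.eval 0) hder
    rwa [eval_linePoly, zero_smul, add_zero, Polynomial.eval_zero] at this
  have := congrArg (Polynomial.eval 0) hzero
  rw [eval_linePoly, zero_smul, add_zero, Polynomial.eval_zero, MvPolynomial.aeval_eq_eval] at this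
  simpa using this

lemma isCubicFree_sq {Q : MvPolynomial (Fin (n + 1)) ℝ}
    (hQ : ∀ i : Fin n, pderiv i.succ (pderiv i.succ Q) = 0) : IsCubicFree (Q ^ 2) := by
  intro i
  simp [sq, Derivation.leibniz, hQ i]

/-- A rank-one direction dominated by `e` with weight `τ ^ 2 * tr` has `τ * tr ≤ 1`. -/
lemma IsHyperbolic.mul_htrace_le_one (hh : IsHyperbolic h e lam) {u : Fin m → ℝ} {τ : ℝ}
    (hrk : hrank lam u ≤ 1)
    (hc : MemCone h e (e - (τ ^ 2 * htrace lam u) • u)) : τ * htrace lam u ≤ 1 := by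
  have key : ∀ j, τ ^ 2 * htrace lam u * lam u j ≤ 1 := by
    intro j
    set κ := τ ^ 2 * htrace lam u
    by_contra hlt
    rw [not_le] at hlt
    have hκ : κ ≠ 0 := by
      intro h0
      rw [h0, zero_mul] at hlt
      linarith
    refine hc (κ * lam u j - 1) (by linarith) ?_
    have h1 : (κ * lam u j - 1) • e + (e - κ • u) = (κ * lam u j) • e - κ • u := by module
    rw [h1, hh.eval_smul_sub_smul u hκ, Finset.prod_eq_zero (Finset.mem_univ j) (sub_self _),
      mul_zero]
  by_cases h0 : ∃ j, lam u j ≠ 0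
  · obtain ⟨j, hj⟩ := h0
    have htr : htrace lam u = lam u j := by
      refine Finset.sum_eq_single j (fun k _ hk => ?_) (by simp)
      by_contra hk0
      have : Subsingleton {i : Fin d // lam u i ≠ 0} :=
        (Finite.card_le_one_iff_subsingleton).1 hrk
      exact hk (congrArg Subtype.val (this.elim ⟨k, hk0⟩ ⟨j, hj⟩))
    have h1 := key j
    rw [← htr] at h1
    nlinarith
  · push Not at h0
    simp [htrace, h0]

lemma IsHyperbolic.lam_self (hh : IsHyperbolic h e lam) (j : Fin d) : lam e j = 1 := by
  have h1 := hh.2.2.2 e (lam e j)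
  rw [Finset.prod_eq_zero (Finset.mem_univ j) (sub_self _), mul_zero] at h1
  have h2 : lam e j • e - e = (lam e j - 1) • e := by module
  rw [h2, eval_smul_of_isHomogeneous hh.1] at h1
  have h3 := (mul_eq_zero.1 h1).resolve_right hh.2.1.ne'
  have := eq_zero_of_pow_eq_zero h3
  linarith

lemma IsHyperbolic.eval_pderiv_hPoly_le (hh : IsHyperbolic h e lam) {τ : Fin n → ℝ}
    {v : Fin n → Fin m → ℝ} (hτ : ∀ i, 0 ≤ τ i) (hv : ∀ i, InCone lam (v i))
    (hrk : ∀ i, hrank lam (v i) ≤ 1) {V : Fin (n + 1) → ℝ} {c : Fin m → ℝ}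
    (hc : MemCone h e c)
    (hV : V 0 • e + ∑ i : Fin n, V i.succ • (τ i • v i) = (2 : ℝ) • e + c) (i : Fin n) :
    eval V (pderiv i.succ (hPoly h e fun i => τ i • v i)) ≤
      τ i * htrace lam (v i) / 2 * eval V (hPoly h e fun i => τ i • v i) := by
  set P := hPoly h e fun i => τ i • v i with hP
  set α := τ i * htrace lam (v i) with hα
  have hα0 : 0 ≤ α := mul_nonneg (hτ i) (Finset.sum_nonneg fun j _ => hv i j)
  have hP2 := hh.pderiv_pderiv_hPoly τ hv hrk i
  have hP0 : eval V P = eval ((2 : ℝ) • e + c) h := by rw [hP, eval_hPoly, hV]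
  have hpos : 0 < eval V P := by rw [hP0]; exact hh.eval_pos_of_memCone hc two_pos
  have key : ∀ β, α / 2 < β → eval V (pderiv i.succ P) < β * eval V P := by
    intro β hβ
    have hβ0 : 0 < β := by linarith
    have h1 := aeval_add_single_of_cubic (K := ℝ) P i.succ (by rw [hP2, map_zero]) V (-β⁻¹)
    rw [hP2] at h1
    simp only [MvPolynomial.aeval_eq_eval, map_zero, mul_zero, add_zero] at h1
    have h2 : 0 < eval (V + (-β⁻¹) • (Pi.single i.succ 1 : Fin (n + 1) → ℝ)) P := by
      rw [hP, eval_hPoly]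
      have h3 : (V + (-β⁻¹) • (Pi.single i.succ 1 : Fin (n + 1) → ℝ)) 0 = V 0 := by
        simp
      have h4 : ∀ k : Fin n,
          (V + (-β⁻¹) • (Pi.single i.succ 1 : Fin (n + 1) → ℝ)) k.succ • (τ k • v k)
          = V k.succ • (τ k • v k) + if k = i then (-β⁻¹ * τ i) • v i else 0 := by
        intro k
        by_cases hk : k = i
        · subst hk
          simp [smul_smul]
          module
        · simp [hk]
      have h5 : (V + (-β⁻¹) • (Pi.single i.succ 1 : Fin (n + 1) → ℝ)) 0 • e +
          ∑ k : Fin n, (V + (-β⁻¹) • (Pi.single i.succ 1 : Fin (n + 1) → ℝ)) k.succ • (τ k • v k) =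
          (2 - α / β) • e + (((α / β) • e - (τ i / β) • v i) + c) := by
        rw [h3, Finset.sum_congr rfl fun k _ => h4 k, Finset.sum_add_distrib,
          Finset.sum_ite_eq' Finset.univ i, if_pos (Finset.mem_univ i), ← add_assoc, hV,
          div_eq_mul_inv (τ i)]
        module
      rw [h5]
      have h6 : MemCone h e ((α / β) • e - (τ i / β) • v i) := by
        by_cases hτi : τ i = 0
        · simpa [hα, hτi] using hh.memCone_zero
        refine hh.memCone_smul_sub_smul (div_ne_zero hτi hβ0.ne') fun j => ?_
        rw [hα, div_mul_eq_mul_div]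
        have : lam (v i) j ≤ htrace lam (v i) :=
          Finset.single_le_sum (fun k _ => hv i k) (Finset.mem_univ j)
        have := hτ i
        gcongr
      refine hh.eval_pos_of_memCone (h6.add hh hc) ?_
      rw [sub_pos, div_lt_iff₀ hβ0]
      linarith
    rw [h1] at h2
    have h7 : β * (eval V P + -β⁻¹ * eval V (pderiv i.succ P)) =
        β * eval V P - eval V (pderiv i.succ P) := by field_simp; ring
    have := mul_pos hβ0 h2
    linarith
  refine le_of_forall_pos_lt_add fun ε hε => ?_
  have h1 := key (α / 2 + ε / eval V P) (by have := div_pos hε hpos; linarith)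
  rwa [add_mul, div_mul_cancel₀ _ hpos.ne'] at h1

end HPoly
/-- Barrier bound: `(4, 0, …, 0)` is above all roots of
`∏ i (1 - (1/2) ∂²_{z i}) [h(xe + ∑ z i τ i v i)]²`. -/
theorem kls_barrier_bound
    {m d n : ℕ} (h : MvPolynomial (Fin m) ℝ) (e : Fin m → ℝ)
    (lam : (Fin m → ℝ) → Fin d → ℝ)
    (hhyp : IsHyperbolic h e lam) (he : InOpenCone lam e)
    (S : Fin n → Finset ℝ) (p : Fin n → ℝ → ℝ)
    (hS : ∀ i, (S i).Nonempty)
    (hp : ∀ i, ∀ a ∈ S i, 0 < p i a)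
    (hp1 : ∀ i, ∑ a ∈ S i, p i a = 1)
    (μ τ : Fin n → ℝ)
    (hμ : ∀ i, μ i = ∑ a ∈ S i, p i a * a)
    (hτ0 : ∀ i, 0 ≤ τ i)
    (hτ : ∀ i, τ i ^ 2 = ∑ a ∈ S i, p i a * (a - μ i) ^ 2)
    (v : Fin n → Fin m → ℝ)
    (hv : ∀ i, InCone lam (v i))
    (hvrank : ∀ i, hrank lam (v i) ≤ 1)
    (hprec : ∀ j, lam (∑ i, (τ i ^ 2 * htrace lam (v i)) • v i) j ≤ lam e j) :
    AboveRoots (opAll ((hPoly h e fun i => τ i • v i) ^ 2))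
      (Fin.cons (4 : ℝ) fun _ => (0 : ℝ)) := by
  have hw : ∀ i, MemCone h e (τ i • v i) := by
    intro i
    rcases (hτ0 i).eq_or_lt with h0 | h0
    · rw [← h0, zero_smul]
      exact hhyp.memCone_zero
    · exact (hhyp.memCone_of_inCone (hv i)).smul hhyp.1 h0
  set B := ∑ i, (τ i ^ 2 * htrace lam (v i)) • v i with hB
  have heB : MemCone h e (e - B) := by
    have := hhyp.memCone_smul_sub_smul (y := B) (x := 1) (z := 1) one_ne_zero fun j => by
      rw [one_mul, ← hhyp.lam_self j]
      exact hprec j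
    simpa using this
  have htr : ∀ i, 0 ≤ htrace lam (v i) := fun i => Finset.sum_nonneg fun j _ => hv i j
  set α : Fin n → ℝ := fun i => τ i * htrace lam (v i) with hα
  have hBw : ∑ i, α i • (τ i • v i) = B := by
    refine Finset.sum_congr rfl fun i _ => ?_
    rw [hα, smul_smul]
    congr 1
    ring
  have hα0 : ∀ i, 0 ≤ α i := fun i => mul_nonneg (hτ0 i) (htr i)
  have hsmul : ∀ (s : ℝ) (c : Fin m → ℝ), 0 ≤ s → MemCone h e c → MemCone h e (s • c) := by
    intro s c hs hc
    rcases hs.eq_or_lt with h0 | h0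
    · rw [← h0, zero_smul]
      exact hhyp.memCone_zero
    · exact hc.smul hhyp.1 h0
  have hα1 : ∀ i, α i ≤ 1 := by
    intro i
    refine hhyp.mul_htrace_le_one (hvrank i) ?_
    have h1 : e - (τ i ^ 2 * htrace lam (v i)) • v i =
        (e - B) + ∑ k ∈ Finset.univ.erase i, α k • (τ k • v k) := by
      rw [← hBw, ← Finset.add_sum_erase _ _ (Finset.mem_univ i), smul_smul]
      have : α i * τ i = τ i ^ 2 * htrace lam (v i) := by rw [hα]; ring
      rw [this]
      abel
    rw [h1]
    exact heB.add hhyp (hhyp.memCone_sum _ _ fun k _ => hsmul _ _ (hα0 k) (hw k))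
  set P := hPoly h e fun i => τ i • v i with hP
  set b : Fin (n + 1) → ℝ := Fin.cons 4 fun i => -(2 * α i) with hb
  have hinit : ∀ t : Fin (n + 1) → ℝ, (∀ k, 0 ≤ t k) → 0 < eval (b + t) (P ^ 2) ∧
      ∀ i, eval (b + t) (pderiv i.succ (P ^ 2)) ≤ α i * eval (b + t) (P ^ 2) := by
    intro t ht
    set c := (2 : ℝ) • (e - B) + (t 0 • e + ∑ i : Fin n, t i.succ • (τ i • v i)) with hc
    have he' : MemCone h e e := hhyp.memCone_of_inCone fun j => (he j).le
    have hcm : MemCone h e c :=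
      (hsmul _ _ zero_le_two heB).add hhyp ((hsmul _ _ (ht 0) he').add hhyp
        (hhyp.memCone_sum _ _ fun k _ => hsmul _ _ (ht k.succ) (hw k)))
    have hV : (b + t) 0 • e + ∑ i : Fin n, (b + t) i.succ • (τ i • v i) = (2 : ℝ) • e + c := by
      simp only [Pi.add_apply, hb, Fin.cons_zero, Fin.cons_succ, add_smul (-(2 * α _)),
        Finset.sum_add_distrib, neg_smul, Finset.sum_neg_distrib, mul_smul (2 : ℝ),
        ← Finset.smul_sum]
      rw [hBw, hc]
      module
    have hpos : 0 < eval (b + t) P := by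
      rw [hP, eval_hPoly, hV]
      exact hhyp.eval_pos_of_memCone hcm two_pos
    refine ⟨by rw [map_pow]; positivity, fun i => ?_⟩
    have h1 := hhyp.eval_pderiv_hPoly_le hτ0 hv hvrank hcm hV i
    have h2 : eval (b + t) (pderiv i.succ (P ^ 2)) =
        2 * eval (b + t) P * eval (b + t) (pderiv i.succ P) := by
      simp [sq, Derivation.leibniz]
      ring
    rw [h2, map_pow]
    have h3 := mul_le_mul_of_nonneg_left h1 (mul_pos two_pos hpos).le
    calc _ ≤ _ := h3
      _ = _ := by rw [hα]; ring
  intro t ht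
  have hmain := eval_foldl_opOne_pos α hα1 (List.finRange n) (P ^ 2) b
    (hhyp.isStable_hPoly hw).sq (isCubicFree_sq fun i => hhyp.pderiv_pderiv_hPoly τ hv hvrank i)
    hinit t ht
  have hpt : b + ((List.finRange n).map fun i =>
      (2 * α i) • (Pi.single i.succ 1 : Fin (n + 1) → ℝ)).sum = Fin.cons 4 fun _ => 0 := by
    rw [← List.ofFn_eq_map, List.sum_ofFn]
    ext k
    refine Fin.cases ?_ (fun j => ?_) k
    · simp [hb, Finset.sum_apply]
    · simp [hb, Finset.sum_apply, Pi.single_apply]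
  rw [hpt] at hmain
  exact hmain
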